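/- arXiv:math/0205032 — 3 statements merged into one kernel-verified Lean document; each statement's English description precedes it below -/
import Mathlib

section
/- Let δ > 0 and let (μ_k)_{k≥0} be a nested-partition family of probability measures on [0,1] with distortion δ as in the context, and let μ be a weak limit of the sequence (μ_k). Set β = ln(1+δ)/ln 100. Then every Borel set S ⊆ [0,1] with μ(S) = 1 has Hausdorff dimension at least 1 − β. In particular, the Hausdorff dimension of any Borel set of full μ-measure tends to 1 as δ → 0. -/
open MeasureTheory Filter Topology

/-- A bounded-distortion sequence starting from a measure below Lebesgue measure satisfies the
iterated density bound. -/
lemma measure_le_pow_mul_volume {δ : ENNReal} {μ : ℕ → Measure ℝ} (h0 : μ 0 ≤ volume)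
    (hac : ∀ k : ℕ, ∀ A : Set ℝ, MeasurableSet A → μ (k + 1) A ≤ δ * μ k A)
    (k : ℕ) {A : Set ℝ} (hA : MeasurableSet A) : μ k A ≤ δ ^ k * volume A := by
  induction k with
  | zero => simpa using h0 A
  | succ k ih =>
    calc μ (k + 1) A ≤ δ * μ k A := hac k A hA
      _ ≤ δ * (δ ^ k * volume A) := by gcongr
      _ = δ ^ (k + 1) * volume A := by rw [pow_succ', mul_assoc]

/-- If each measure is dominated by a multiple of the previous one, null sets stay null. -/
lemma measure_eq_zero_of_le {δ : ENNReal} {μ : ℕ → Measure ℝ}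
    (hac : ∀ k : ℕ, ∀ A : Set ℝ, MeasurableSet A → μ (k + 1) A ≤ δ * μ k A)
    {k l : ℕ} (hkl : k ≤ l) {A : Set ℝ} (hA : MeasurableSet A) (h : μ k A = 0) : μ l A = 0 := by
  induction l, hkl using Nat.le_induction with
  | base => exact h
  | succ l _ ih => simpa [ih] using hac l A hA

/-- If `μ` and `ν` agree on the members of a countable disjoint family that carries `μ`, and every
member meeting `U` lies in `V`, then `μ U ≤ ν V`. -/
lemma measure_le_of_countable_partition {C : Set (Set ℝ)} (hC : C.Countable)
    (hd : C.Pairwise Disjoint) (hm : ∀ I ∈ C, MeasurableSet I) {μ ν : Measure ℝ}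
    (hμ : μ (⋃₀ C)ᶜ = 0) (heq : ∀ I ∈ C, μ I = ν I) {U V : Set ℝ}
    (hUV : ∀ I ∈ C, (I ∩ U).Nonempty → I ⊆ V) : μ U ≤ ν V := by
  set D : Set (Set ℝ) := {I ∈ C | (I ∩ U).Nonempty} with hD
  have hDC : D ⊆ C := fun _ h => h.1
  have hsub : U ⊆ ⋃₀ D ∪ (⋃₀ C)ᶜ := by
    intro x hx
    by_cases h : x ∈ ⋃₀ C
    · obtain ⟨I, hI, hxI⟩ := h
      exact Or.inl ⟨I, ⟨hI, x, hxI, hx⟩, hxI⟩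
    · exact Or.inr h
  have hDc := hC.mono hDC
  calc μ U ≤ μ (⋃₀ D) + μ (⋃₀ C)ᶜ := (measure_mono hsub).trans (measure_union_le _ _)
    _ = μ (⋃₀ D) := by rw [hμ, add_zero]
    _ = ∑' I : D, μ I := measure_sUnion hDc (hd.mono hDC) fun I hI => hm I (hDC hI)
    _ = ∑' I : D, ν I := tsum_congr fun I => heq I (hDC I.2)
    _ = ν (⋃₀ D) := (measure_sUnion hDc (hd.mono hDC) fun I hI => hm I (hDC hI)).symm
    _ ≤ ν V := measure_mono (Set.sUnion_subset fun I hI => hUV I hI.1 hI.2)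

/-- Mass distribution principle along the scales `100 ^ (-k)`. -/
lemma measure_le_mul_ediam_rpow {ν : Measure ℝ} {d c : ℝ} (hd : 0 < d) (hc : 0 ≤ c)
    (h : ∀ k : ℕ, 1 ≤ k → ∀ s : Set ℝ, Metric.ediam s ≤ ENNReal.ofReal ((1 / 100) ^ k) →
      ν s ≤ ENNReal.ofReal (c * ((1 / 100) ^ k) ^ d))
    {s : Set ℝ} (hs : Metric.ediam s ≤ ENNReal.ofReal (1 / 100)) :
    ν s ≤ ENNReal.ofReal (c * 100 ^ d) * Metric.ediam s ^ d := by
  have hfin : Metric.ediam s ≠ ⊤ := ne_top_of_le_ne_top ENNReal.ofReal_ne_top hs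
  obtain ⟨r, hr⟩ : ∃ r, r = (Metric.ediam s).toReal := ⟨_, rfl⟩
  have hrs : Metric.ediam s = ENNReal.ofReal r := by rw [hr, ENNReal.ofReal_toReal hfin]
  have hr0 : 0 ≤ r := hr ▸ ENNReal.toReal_nonneg
  rw [hrs] at hs ⊢
  rw [ENNReal.ofReal_le_ofReal_iff (by norm_num)] at hs
  rcases hr0.eq_or_lt with hr0' | hrpos
  · have hlim : Tendsto (fun k : ℕ => ENNReal.ofReal (c * ((1 / 100 : ℝ) ^ k) ^ d)) atTop
        (𝓝 (ENNReal.ofReal (c * 0 ^ d))) :=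
      ENNReal.tendsto_ofReal (((tendsto_pow_atTop_nhds_zero_of_lt_one (by norm_num)
        (by norm_num)).rpow_const (Or.inr hd.le)).const_mul c)
    have : ν s ≤ ENNReal.ofReal (c * 0 ^ d) := by
      refine ge_of_tendsto hlim ?_
      filter_upwards [eventually_ge_atTop 1] with k hk
      exact h k hk s (by rw [hrs, ← hr0']; simp)
    rw [Real.zero_rpow hd.ne', mul_zero, ENNReal.ofReal_zero] at this
    exact this.trans zero_le
  · obtain ⟨k, hk1, hk2⟩ := exists_nat_pow_near_of_lt_one (y := (1 / 100 : ℝ)) hrpos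
      (by linarith) (by norm_num) (by norm_num)
    have hk : 1 ≤ k := by
      rcases Nat.eq_zero_or_pos k with rfl | hk
      · norm_num at hk1 hs; linarith
      · exact hk
    refine (h k hk s (by rw [hrs]; exact ENNReal.ofReal_le_ofReal hk2)).trans ?_
    rw [ENNReal.ofReal_rpow_of_pos hrpos, ← ENNReal.ofReal_mul (by positivity)]
    refine ENNReal.ofReal_le_ofReal ?_
    rw [mul_assoc, ← Real.mul_rpow (by norm_num) hr0]
    have : (1 / 100 : ℝ) ^ k ≤ 100 * r := by rw [pow_succ] at hk1; linarith
    gcongr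

/-- A nonzero mass obeying a power bound on small sets forces a lower bound on `dimH`. -/
lemma le_dimH_of_measure_le {ν : Measure ℝ} {d C ε : ℝ} (hd : 0 ≤ d) (hC : 0 < C) (hε : 0 < ε)
    (h : ∀ s : Set ℝ, Metric.ediam s ≤ ENNReal.ofReal ε →
      ν s ≤ ENNReal.ofReal C * Metric.ediam s ^ d) {S : Set ℝ} (hS : ν S ≠ 0) :
    ENNReal.ofReal d ≤ dimH S := by
  have hC0 : ENNReal.ofReal C ≠ 0 := by simpa using hC
  have hle : (ENNReal.ofReal C)⁻¹ • ν ≤ Measure.hausdorffMeasure d := by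
    refine Measure.le_hausdorffMeasure d _ (ENNReal.ofReal ε) (by simpa using hε) fun s hs => ?_
    rw [Measure.smul_apply, smul_eq_mul, mul_comm, ← div_eq_mul_inv]
    exact ENNReal.div_le_of_le_mul' (h s hs)
  refine le_dimH_of_hausdorffMeasure_ne_zero (d := d.toNNReal) ?_
  rw [Real.coe_toNNReal d hd]
  have hpos : ((ENNReal.ofReal C)⁻¹ • ν) S ≠ 0 := by
    simp [hS, Measure.smul_apply]
  exact fun h0 => hpos (le_antisymm ((hle S).trans h0.le) zero_le)

/-- Lemma 7.3 (MesDist), dimension bound: every Borel set of full measure for a weak limit `ν`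
of a nested-partition family of probability measures on `[0,1]` with distortion `δ` has
Hausdorff dimension at least `1 − β`, where `β = ln(1+δ)/ln 100`. -/
theorem stmt_8
    (δ : ℝ) (hδ : 0 < δ)
    (μ : ℕ → ProbabilityMeasure ℝ)
    (h0 : (μ 0 : Measure ℝ) = volume.restrict (Set.Icc (0 : ℝ) 1))
    (C : ℕ → Set (Set ℝ))
    (hcount : ∀ k : ℕ, 1 ≤ k → (C k).Countable)
    (hinterval : ∀ k : ℕ, 1 ≤ k → ∀ I ∈ C k, ∃ a b : ℝ, a ≤ b ∧ I = Set.Icc a b ∧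
      I ⊆ Set.Icc (0 : ℝ) 1 ∧ b - a ≤ (100 : ℝ) ^ (-(k : ℝ)))
    (hdisj : ∀ k : ℕ, 1 ≤ k → (C k).Pairwise Disjoint)
    (hfull : ∀ k : ℕ, 1 ≤ k → (μ k : Measure ℝ) (⋃₀ C k) = 1)
    (hnest : ∀ k : ℕ, 1 ≤ k → ∀ I ∈ C (k + 1), ∃ J ∈ C k, I ⊆ J)
    (hconst : ∀ k : ℕ, 1 ≤ k → ∀ I ∈ C k, ∀ l : ℕ, k ≤ l →
      (μ l : Measure ℝ) I = (μ k : Measure ℝ) I)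
    (hac : ∀ k : ℕ, ∀ A : Set ℝ, MeasurableSet A →
      (μ (k + 1) : Measure ℝ) A ≤ ENNReal.ofReal (1 + δ) * (μ k : Measure ℝ) A)
    (ν : ProbabilityMeasure ℝ)
    (hweak : Tendsto μ atTop (𝓝 ν)) :
    ∀ S : Set ℝ, MeasurableSet S → S ⊆ Set.Icc (0 : ℝ) 1 → (ν : Measure ℝ) S = 1 →
      ENNReal.ofReal (1 - Real.log (1 + δ) / Real.log 100) ≤ dimH S := by
  intro S _ _ hS
  rcases le_or_gt (1 - Real.log (1 + δ) / Real.log 100) 0 with hd | hd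
  · rw [ENNReal.ofReal_of_nonpos hd]; exact zero_le
  set d := 1 - Real.log (1 + δ) / Real.log 100 with hd_def
  have hscale : (1 + δ) * (1 / 100) = (1 / 100 : ℝ) ^ d := by
    have hlog : Real.log 100 ≠ 0 := (Real.log_pos (by norm_num)).ne'
    rw [Real.rpow_def_of_pos (by norm_num), one_div, Real.log_inv, hd_def,
      show -Real.log 100 * (1 - Real.log (1 + δ) / Real.log 100)
        = Real.log (1 + δ) + -Real.log 100 by field_simp; ring,
      Real.exp_add, Real.exp_neg, Real.exp_log (by linarith), Real.exp_log (by norm_num)]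
  refine le_dimH_of_measure_le (ν := (ν : Measure ℝ)) (C := 6 * 100 ^ d) (ε := 1 / 100) hd.le
    (by positivity) (by norm_num)
    (fun s hs => measure_le_mul_ediam_rpow hd (by norm_num) ?_ hs) (by rw [hS]; exact one_ne_zero)
  intro k hk s hs
  set ρ : ℝ := (1 / 100) ^ k with hρ
  have hρ0 : 0 < ρ := by positivity
  rcases s.eq_empty_or_nonempty with rfl | ⟨x, hx⟩
  · simp
  have hsub : s ⊆ Metric.ball x (2 * ρ) := by
    intro y hy
    have h1 : edist y x ≤ ENNReal.ofReal ρ := (Metric.edist_le_ediam_of_mem hy hx).trans hs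
    rw [edist_dist, ENNReal.ofReal_le_ofReal_iff hρ0.le] at h1
    rw [Metric.mem_ball]; linarith
  have hmeas : ∀ I ∈ C k, MeasurableSet I := by
    intro I hI
    obtain ⟨a, b, -, rfl, -⟩ := hinterval k hk I hI
    exact measurableSet_Icc
  have hmeasU : MeasurableSet (⋃₀ C k) := MeasurableSet.sUnion (hcount k hk) hmeas
  have hnull : (μ k : Measure ℝ) (⋃₀ C k)ᶜ = 0 := (prob_compl_eq_zero_iff hmeasU).2 (hfull k hk)
  have hbound : ∀ l, k ≤ l →
      (μ l : Measure ℝ) (Metric.ball x (2 * ρ)) ≤ (μ k : Measure ℝ) (Metric.ball x (3 * ρ)) := by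
    intro l hl
    refine measure_le_of_countable_partition (hcount k hk) (hdisj k hk) hmeas
      (measure_eq_zero_of_le (μ := fun n => (μ n : Measure ℝ)) hac hl hmeasU.compl hnull)
      (fun I hI => hconst k hk I hI l hl) ?_
    intro I hI hne z hz
    obtain ⟨a, b, -, rfl, -, hab⟩ := hinterval k hk I hI
    obtain ⟨y, hyI, hyx⟩ := hne
    have hab' : b - a ≤ ρ := by
      rwa [Real.rpow_neg (by norm_num), Real.rpow_natCast, ← inv_pow, ← one_div] at hab
    have hzy : dist z y ≤ b - a := Real.dist_le_of_mem_Icc hz hyI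
    rw [Metric.mem_ball] at hyx ⊢
    linarith [dist_triangle z y x]
  have hlim := ProbabilityMeasure.le_liminf_measure_open_of_tendsto hweak
    (Metric.isOpen_ball (x := x) (ε := 2 * ρ))
  calc (ν : Measure ℝ) s ≤ (ν : Measure ℝ) (Metric.ball x (2 * ρ)) := measure_mono hsub
    _ ≤ (μ k : Measure ℝ) (Metric.ball x (3 * ρ)) :=
      hlim.trans (liminf_le_of_le (by isBoundedDefault) fun b hb => by
        obtain ⟨l, hbl, hl⟩ := (hb.and (eventually_ge_atTop k)).exists
        exact hbl.trans (hbound l hl))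
    _ ≤ ENNReal.ofReal (1 + δ) ^ k * volume (Metric.ball x (3 * ρ)) :=
      measure_le_pow_mul_volume (μ := fun n => (μ n : Measure ℝ))
        (by simpa only [h0] using Measure.restrict_le_self) hac k Metric.isOpen_ball.measurableSet
    _ = ENNReal.ofReal (6 * ρ ^ d) := by
      rw [Real.volume_ball, ← ENNReal.ofReal_pow (by linarith),
        ← ENNReal.ofReal_mul (by positivity)]
      congr 1
      rw [hρ, ← Real.rpow_pow_comm (by norm_num), ← hscale, mul_pow]
      ring
end

section
/- The set { x ∈ [0,1) : liminf_{n→∞} η_n(x)/n > 1/2 } of points of the unit interval at which the binary digit 1 occurs with lower asymptotic frequency strictly greater than 1/2 has Lebesgue measure zero and Hausdorff dimension equal to 1. -/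
open MeasureTheory Filter
open scoped Classical

/-- The doubling map `x ↦ 2x mod 1`. -/
noncomputable def doubling (x : ℝ) : ℝ := Int.fract (2 * x)

/-- The points whose first binary digit is `1`. -/
def oneDigit : Set ℝ := {x | 1 / 2 ≤ Int.fract x}

/-- Lebesgue measure on the unit interval. -/
noncomputable def unitMeasure : Measure ℝ := volume.restrict (Set.Ico 0 1)

instance : IsProbabilityMeasure unitMeasure := ⟨by simp [unitMeasure]⟩

lemma measurable_doubling : Measurable doubling :=
  measurable_fract.comp (measurable_const_mul 2)

lemma measurableSet_oneDigit : MeasurableSet oneDigit :=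
  measurableSet_le measurable_const measurable_fract

lemma fract_doubling_iterate (k : ℕ) (x : ℝ) :
    Int.fract (doubling^[k] x) = Int.fract (2 ^ k * x) := by
  induction k generalizing x with
  | zero => simp
  | succ k ih =>
    rw [Function.iterate_succ_apply, ih, Int.fract_eq_fract]
    refine ⟨-(2 ^ k * ⌊2 * x⌋), ?_⟩
    rw [doubling, Int.fract]
    push_cast
    ring

lemma volume_doubling_preimage_left (B : Set ℝ) :
    volume (doubling ⁻¹' B ∩ Set.Ico 0 (1 / 2)) = 2⁻¹ * volume (B ∩ Set.Ico 0 1) := by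
  have h : doubling ⁻¹' B ∩ Set.Ico 0 (1 / 2) = (2 * ·) ⁻¹' (B ∩ Set.Ico 0 1) := by
    ext x
    have (h0 : 0 ≤ x) (h1 : x < 1 / 2) : doubling x = 2 * x :=
      Int.fract_eq_self.2 ⟨by linarith, by linarith⟩
    simp only [Set.mem_inter_iff, Set.mem_preimage, Set.mem_Ico]
    constructor
    · rintro ⟨h, h0, h1⟩
      exact ⟨this h0 h1 ▸ h, by linarith, by linarith⟩
    · rintro ⟨h, h0, h1⟩
      have h0' : 0 ≤ x := by linarith
      have h1' : x < 1 / 2 := by linarith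
      exact ⟨(this h0' h1').symm ▸ h, h0', h1'⟩
  rw [h, Real.volume_preimage_mul_left two_ne_zero]
  congr 1
  rw [abs_of_pos (by norm_num), ENNReal.ofReal_inv_of_pos two_pos]
  simp

lemma volume_doubling_preimage_right (B : Set ℝ) :
    volume (doubling ⁻¹' B ∩ Set.Ico (1 / 2) 1) = 2⁻¹ * volume (B ∩ Set.Ico 0 1) := by
  have h : doubling ⁻¹' B ∩ Set.Ico (1 / 2) 1 =
      (2 * ·) ⁻¹' ((· + (-1 : ℝ)) ⁻¹' (B ∩ Set.Ico 0 1)) := by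
    ext x
    have (h0 : 1 / 2 ≤ x) (h1 : x < 1) : doubling x = 2 * x + -1 :=
      Int.fract_eq_iff.2 ⟨by linarith, by linarith, 1, by push_cast; ring⟩
    simp only [Set.mem_inter_iff, Set.mem_preimage, Set.mem_Ico]
    constructor
    · rintro ⟨h, h0, h1⟩
      exact ⟨this h0 h1 ▸ h, by linarith, by linarith⟩
    · rintro ⟨h, h0, h1⟩
      have h0' : 1 / 2 ≤ x := by linarith
      have h1' : x < 1 := by linarith
      exact ⟨(this h0' h1').symm ▸ h, h0', h1'⟩
  rw [h, Real.volume_preimage_mul_left two_ne_zero, measure_preimage_add_right]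
  congr 1
  rw [abs_of_pos (by norm_num), ENNReal.ofReal_inv_of_pos two_pos]
  simp

lemma measurePreserving_doubling : MeasurePreserving doubling unitMeasure unitMeasure := by
  refine ⟨measurable_doubling, Measure.ext fun B hB => ?_⟩
  rw [Measure.map_apply measurable_doubling hB, unitMeasure,
    Measure.restrict_apply (measurable_doubling hB), Measure.restrict_apply hB,
    ← Set.Ico_union_Ico_eq_Ico (b := (1 / 2 : ℝ)) (by norm_num) (by norm_num),
    Set.inter_union_distrib_left, measure_union _ ((measurable_doubling hB).inter measurableSet_Ico),
    volume_doubling_preimage_left, volume_doubling_preimage_right, ← add_mul,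
    ENNReal.inv_two_add_inv_two, one_mul, Set.Ico_union_Ico_eq_Ico (by norm_num) (by norm_num)]
  exact Set.Ico_disjoint_Ico_same.mono Set.inter_subset_right Set.inter_subset_right

lemma oneDigit_inter_Ico : oneDigit ∩ Set.Ico 0 1 = Set.Ico (1 / 2) 1 := by
  ext x
  simp only [oneDigit, Set.mem_inter_iff, Set.mem_ofPred_eq, Set.mem_Ico]
  constructor
  · rintro ⟨h, h0, h1⟩
    rw [Int.fract_eq_self.2 ⟨h0, h1⟩] at h
    exact ⟨h, h1⟩
  · rintro ⟨h0, h1⟩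
    have h0' : 0 ≤ x := by linarith
    rw [Int.fract_eq_self.2 ⟨h0', h1⟩]
    exact ⟨h0, h0', h1⟩

lemma unitMeasure_oneDigit : unitMeasure oneDigit = 2⁻¹ := by
  rw [unitMeasure, Measure.restrict_apply measurableSet_oneDigit, oneDigit_inter_Ico,
    Real.volume_Ico, show (1 - 1 / 2 : ℝ) = 2⁻¹ by norm_num, ENNReal.ofReal_inv_of_pos two_pos]
  simp

lemma unitMeasure_oneDigit_inter {B : Set ℝ} (hB : MeasurableSet B) :
    unitMeasure (oneDigit ∩ doubling ⁻¹' B) = 2⁻¹ * unitMeasure B := by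
  rw [unitMeasure, Measure.restrict_apply (measurableSet_oneDigit.inter (measurable_doubling hB)),
    Measure.restrict_apply hB, ← volume_doubling_preimage_right, ← oneDigit_inter_Ico]
  congr 1
  ext x
  simp only [Set.mem_inter_iff]
  tauto

lemma measurePreserving_doubling_iterate (k : ℕ) :
    MeasurePreserving doubling^[k] unitMeasure unitMeasure :=
  measurePreserving_doubling.iterate k

lemma indepSet_oneDigit {i j : ℕ} (hij : i < j) :
    ProbabilityTheory.IndepSet (doubling^[i] ⁻¹' oneDigit) (doubling^[j] ⁻¹' oneDigit)
      unitMeasure := by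
  have hm (k : ℕ) : MeasurableSet (doubling^[k] ⁻¹' oneDigit) :=
    (measurePreserving_doubling_iterate k).measurable measurableSet_oneDigit
  have hk (k : ℕ) : unitMeasure (doubling^[k] ⁻¹' oneDigit) = 2⁻¹ := by
    rw [(measurePreserving_doubling_iterate k).measure_preimage
      measurableSet_oneDigit.nullMeasurableSet, unitMeasure_oneDigit]
  rw [ProbabilityTheory.indepSet_iff_measure_inter_eq_mul (hm i) (hm j) unitMeasure, hk, hk]
  obtain ⟨d, rfl⟩ := Nat.exists_eq_add_of_lt hij
  have : doubling^[i] ⁻¹' oneDigit ∩ doubling^[i + d + 1] ⁻¹' oneDigit =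
      doubling^[i] ⁻¹' (oneDigit ∩ doubling ⁻¹' (doubling^[d] ⁻¹' oneDigit)) := by
    rw [show i + d + 1 = d + 1 + i by ring, Function.iterate_add, Function.iterate_succ]
    rfl
  rw [this, (measurePreserving_doubling_iterate i).measure_preimage
      (measurableSet_oneDigit.inter (measurable_doubling (hm d))).nullMeasurableSet,
    unitMeasure_oneDigit_inter (hm d), hk]

/-- The `k`-th binary digit. -/
noncomputable def binDigit (k : ℕ) : ℝ → ℝ := (doubling^[k] ⁻¹' oneDigit).indicator fun _ => 1

/-- The number of digits `1` among the first `n` binary digits. -/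
noncomputable def onesCount (n : ℕ) (x : ℝ) : ℕ :=
  ((Finset.range n).filter fun k : ℕ => (1 : ℝ) / 2 ≤ Int.fract ((2 : ℝ) ^ k * x)).card

lemma sum_binDigit (n : ℕ) (x : ℝ) :
    ∑ k ∈ Finset.range n, binDigit k x = (onesCount n x : ℝ) := by
  simp [onesCount, binDigit, Set.indicator_apply, oneDigit, fract_doubling_iterate]

open ProbabilityTheory in
lemma ae_tendsto_onesCount_div :
    ∀ᵐ x ∂unitMeasure, Tendsto (fun n : ℕ => (onesCount n x : ℝ) / n) atTop (nhds (1 / 2)) := by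
  have hm (k : ℕ) : MeasurableSet (doubling^[k] ⁻¹' oneDigit) :=
    (measurePreserving_doubling_iterate k).measurable measurableSet_oneDigit
  have hmeas : Measurable (binDigit 0) := measurable_const.indicator (hm 0)
  have h := strong_law_ae_real (μ := unitMeasure) binDigit ?_ ?_ ?_
  · have he : ∫ x, binDigit 0 x ∂unitMeasure = 1 / 2 := by
      rw [binDigit, integral_indicator_const _ (hm 0), Measure.real]
      simp [unitMeasure_oneDigit]
    simpa only [he, sum_binDigit] using h
  · exact (integrable_const _).indicator (hm 0)
  · have key {i j : ℕ} (hij : i < j) : IndepFun (binDigit i) (binDigit j) unitMeasure :=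
      indep_of_indep_of_le_left (indep_of_indep_of_le_right (indepSet_oneDigit hij)
        (MeasurableSpace.comap_indicator_const_le_generateFrom_singleton _ _))
        (MeasurableSpace.comap_indicator_const_le_generateFrom_singleton _ _)
    intro i j hij
    rcases hij.lt_or_gt with h | h
    · exact key h
    · exact (key h).symm
  · intro k
    have hc : binDigit k = binDigit 0 ∘ doubling^[k] := rfl
    have hp := measurePreserving_doubling_iterate k
    refine ⟨?_, hmeas.aemeasurable, ?_⟩
    · exact (measurable_const.indicator (hm k)).aemeasurable
    · rw [hc, ← Measure.map_map hmeas hp.measurable, hp.map_eq]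

lemma fract_natCast_mul_fract (a : ℕ) (y : ℝ) :
    Int.fract ((a : ℝ) * Int.fract y) = Int.fract (a * y) := by
  rw [Int.fract_eq_fract]
  refine ⟨-(a * ⌊y⌋), ?_⟩
  rw [Int.fract]
  push_cast
  ring

lemma fract_two_pow_mul_fract (k : ℕ) (y : ℝ) :
    Int.fract ((2 : ℝ) ^ k * Int.fract y) = Int.fract (2 ^ k * y) := by
  simpa using fract_natCast_mul_fract (2 ^ k) y

lemma onesCount_fract (n : ℕ) (y : ℝ) : onesCount n (Int.fract y) = onesCount n y := by
  simp only [onesCount, fract_two_pow_mul_fract]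

lemma onesCount_add (a n : ℕ) (y : ℝ) :
    onesCount (a + n) y = onesCount a y + onesCount n (2 ^ a * y) := by
  simp only [onesCount, Finset.card_filter, Finset.sum_range_add, pow_add, mul_assoc,
    mul_left_comm ((2 : ℝ) ^ a)]

lemma onesCount_mono (y : ℝ) : Monotone fun n => onesCount n y := fun _ _ hab =>
  Finset.card_le_card (Finset.filter_subset_filter _ (Finset.range_mono hab))

/-- The `j`-th digit of `x` in base `2 ^ m`. -/
noncomputable def blockDigit (m j : ℕ) (x : ℝ) : ℤ :=
  ⌊(2 : ℝ) ^ m * Int.fract ((2 ^ m) ^ j * x)⌋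

/-- The map that inserts a binary digit `1` after each block of `m` binary digits. -/
noncomputable def insertOnes (m : ℕ) (x : ℝ) : ℝ :=
  ∑' j, (2 * (blockDigit m j x : ℝ) + 1) / (2 ^ (m + 1)) ^ (j + 1)

section insertOnes

variable (m : ℕ) (x : ℝ)

lemma blockDigit_nonneg (j : ℕ) : 0 ≤ (blockDigit m j x : ℝ) := by
  exact_mod_cast Int.floor_nonneg.2 (by positivity)

lemma blockDigit_add_one_le (j : ℕ) : (blockDigit m j x : ℝ) + 1 ≤ 2 ^ m := by
  have h : blockDigit m j x < 2 ^ m := by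
    rw [blockDigit, Int.floor_lt]
    push_cast
    exact mul_lt_of_lt_one_right (by positivity) (Int.fract_lt_one _)
  exact_mod_cast h

lemma blockDigit_term_le (j : ℕ) :
    (2 * (blockDigit m j x : ℝ) + 1) / (2 ^ (m + 1)) ^ (j + 1) ≤
      (1 - (2 ^ (m + 1))⁻¹) * ((2 ^ (m + 1))⁻¹) ^ j := by
  have h := blockDigit_add_one_le m x j
  have h2 : (2 : ℝ) ^ (m + 1) = 2 * 2 ^ m := by ring
  have hL : (0 : ℝ) < 2 ^ (m + 1) := by positivity
  rw [div_le_iff₀ (by positivity)]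
  have : (1 - ((2 : ℝ) ^ (m + 1))⁻¹) * ((2 ^ (m + 1))⁻¹) ^ j * (2 ^ (m + 1)) ^ (j + 1) =
      2 ^ (m + 1) - 1 := by
    rw [inv_pow, pow_succ _ j]
    field_simp
  rw [this]
  linarith

lemma two_pow_succ_inv_lt_one : ((2 : ℝ) ^ (m + 1))⁻¹ < 1 :=
  inv_lt_one_of_one_lt₀ (one_lt_pow₀ one_lt_two (Nat.succ_ne_zero m))

lemma blockDigit_term_nonneg (j : ℕ) :
    0 ≤ (2 * (blockDigit m j x : ℝ) + 1) / (2 ^ (m + 1)) ^ (j + 1) := by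
  have := blockDigit_nonneg m x j
  positivity

lemma hasSum_geometric_bound :
    HasSum (fun j : ℕ => (1 - ((2 : ℝ) ^ (m + 1))⁻¹) * ((2 ^ (m + 1))⁻¹) ^ j) 1 := by
  have h1 := two_pow_succ_inv_lt_one m
  have := (hasSum_geometric_of_lt_one (by positivity) h1).mul_left (1 - ((2 : ℝ) ^ (m + 1))⁻¹)
  rwa [mul_inv_cancel₀ (sub_pos.2 h1).ne'] at this

lemma summable_insertOnes :
    Summable fun j => (2 * (blockDigit m j x : ℝ) + 1) / (2 ^ (m + 1)) ^ (j + 1) :=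
  .of_nonneg_of_le (blockDigit_term_nonneg m x) (blockDigit_term_le m x)
    (hasSum_geometric_bound m).summable

lemma insertOnes_nonneg : 0 ≤ insertOnes m x := tsum_nonneg (blockDigit_term_nonneg m x)

lemma insertOnes_le_one : insertOnes m x ≤ 1 :=
  hasSum_le (blockDigit_term_le m x) (summable_insertOnes m x).hasSum (hasSum_geometric_bound m)

lemma blockDigit_succ (j : ℕ) :
    blockDigit m (j + 1) x = blockDigit m j (Int.fract (2 ^ m * x)) := by
  have := fract_natCast_mul_fract ((2 ^ m) ^ j) (2 ^ m * x)
  push_cast at this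
  rw [blockDigit, blockDigit, this, pow_succ, mul_assoc]

variable {x}

lemma insertOnes_eq (hx : x ∈ Set.Ico (0 : ℝ) 1) :
    insertOnes m x =
      (2 * (⌊2 ^ m * x⌋ : ℝ) + 1 + insertOnes m (Int.fract (2 ^ m * x))) / 2 ^ (m + 1) := by
  have h0 : blockDigit m 0 x = ⌊2 ^ m * x⌋ := by
    rw [blockDigit, pow_zero, one_mul, Int.fract_eq_self.2 ⟨hx.1, hx.2⟩]
  rw [insertOnes, (summable_insertOnes m x).tsum_eq_zero_add, h0, insertOnes,
    add_div _ (∑' _, _), ← tsum_div_const]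
  simp only [blockDigit_succ, zero_add, pow_one, pow_succ _ (_ + 1), div_div]

lemma rpow_sub_le_insertOnes_sub {s : ℝ} (hs : 0 ≤ s) (hms : ((2 : ℝ) ^ m) ^ s = 2 ^ (m + 1))
    (n : ℕ) {x y : ℝ} (hx : x ∈ Set.Ico (0 : ℝ) 1) (hy : y ∈ Set.Ico (0 : ℝ) 1) (hxy : x ≤ y)
    (hn : 1 ≤ (2 ^ m) ^ n * (y - x)) :
    (y - x) ^ s ≤ 2 ^ (m + 1) * (insertOnes m y - insertOnes m x) := by
  induction n generalizing x y with
  | zero =>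
    have h1 := hx.1
    have h2 := hy.2
    rw [pow_zero] at hn
    linarith
  | succ n ih =>
    have hL : (0 : ℝ) < 2 ^ (m + 1) := by positivity
    have hval : 2 ^ (m + 1) * (insertOnes m y - insertOnes m x) =
        2 * ((⌊2 ^ m * y⌋ : ℝ) - ⌊2 ^ m * x⌋) +
          (insertOnes m (Int.fract (2 ^ m * y)) - insertOnes m (Int.fract (2 ^ m * x))) := by
      rw [insertOnes_eq m hx, insertOnes_eq m hy]
      field_simp
      ring
    rw [hval]
    have hle : ⌊2 ^ m * x⌋ ≤ ⌊2 ^ m * y⌋ := Int.floor_mono (by gcongr)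
    rcases hle.eq_or_lt with h | h
    · have hd : Int.fract (2 ^ m * y) - Int.fract (2 ^ m * x) = 2 ^ m * (y - x) := by
        rw [Int.fract, Int.fract, h]
        ring
      have hpos : (0 : ℝ) ≤ 2 ^ m * (y - x) := mul_nonneg (by positivity) (sub_nonneg.2 hxy)
      have := ih (x := Int.fract (2 ^ m * x)) (y := Int.fract (2 ^ m * y))
        ⟨Int.fract_nonneg _, Int.fract_lt_one _⟩ ⟨Int.fract_nonneg _, Int.fract_lt_one _⟩
        (sub_nonneg.1 (hd ▸ hpos)) (by rw [hd, ← mul_assoc, ← pow_succ]; exact hn)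
      rw [hd, Real.mul_rpow (by positivity) (sub_nonneg.2 hxy), hms] at this
      rw [h, sub_self, mul_zero, zero_add]
      exact le_of_mul_le_mul_left this hL
    · have h' : (⌊2 ^ m * x⌋ : ℝ) + 1 ≤ ⌊2 ^ m * y⌋ := by exact_mod_cast h
      have h1 := insertOnes_nonneg m (Int.fract (2 ^ m * y))
      have h2 := insertOnes_le_one m (Int.fract (2 ^ m * x))
      have h3 : (y - x) ^ s ≤ 1 :=
        Real.rpow_le_one (sub_nonneg.2 hxy) (by linarith [hx.1, hy.2]) hs
      linarith

lemma rpow_le_insertOnes_sub (hm : m ≠ 0) {x y : ℝ}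
    (hx : x ∈ Set.Ico (0 : ℝ) 1) (hy : y ∈ Set.Ico (0 : ℝ) 1) (hxy : x < y) :
    (y - x) ^ (((m : ℝ) + 1) / m) ≤ 2 ^ (m + 1) * (insertOnes m y - insertOnes m x) := by
  have hm' : (m : ℝ) ≠ 0 := by exact_mod_cast hm
  obtain ⟨n, hn⟩ := pow_unbounded_of_one_lt (1 / (y - x)) (one_lt_pow₀ (one_lt_two (α := ℝ)) hm)
  refine rpow_sub_le_insertOnes_sub m (by positivity) ?_ n hx hy hxy.le ?_
  · rw [← Real.rpow_natCast, ← Real.rpow_mul zero_le_two, mul_div_cancel₀ _ hm',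
      ← Real.rpow_natCast]
    push_cast
    rfl
  · rw [div_lt_iff₀ (sub_pos.2 hxy)] at hn
    exact hn.le

lemma insertOnes_strictMonoOn (hm : m ≠ 0) : StrictMonoOn (insertOnes m) (Set.Ico (0 : ℝ) 1) := by
  intro x hx y hy hxy
  have h := (Real.rpow_pos_of_pos (sub_pos.2 hxy) _).trans_le (rpow_le_insertOnes_sub m hm hx hy hxy)
  exact sub_pos.1 (pos_of_mul_pos_right h (by positivity))

lemma insertOnes_mem_Ico (hm : m ≠ 0) (hx : x ∈ Set.Ico (0 : ℝ) 1) :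
    insertOnes m x ∈ Set.Ico (0 : ℝ) 1 := by
  obtain ⟨y, hxy, hy⟩ := exists_between hx.2
  exact ⟨insertOnes_nonneg m x,
    (insertOnes_strictMonoOn m hm hx ⟨hx.1.trans hxy.le, hy⟩ hxy).trans_le (insertOnes_le_one m y)⟩

lemma dist_le_insertOnes (hm : m ≠ 0) {x y : ℝ}
    (hx : x ∈ Set.Ico (0 : ℝ) 1) (hy : y ∈ Set.Ico (0 : ℝ) 1) :
    dist x y ≤ (2 ^ (m + 1)) ^ ((m : ℝ) / (m + 1)) *
      dist (insertOnes m x) (insertOnes m y) ^ ((m : ℝ) / (m + 1)) := by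
  have hm' : (0 : ℝ) < m := by exact_mod_cast Nat.pos_of_ne_zero hm
  wlog hxy : x < y generalizing x y
  · rcases (not_lt.1 hxy).eq_or_lt with rfl | h
    · rw [dist_self]
      positivity
    · rw [dist_comm, dist_comm (insertOnes m x)]
      exact this hy hx h
  have hd : dist x y = y - x := by rw [dist_comm, Real.dist_eq, abs_of_pos (sub_pos.2 hxy)]
  have hd' : dist (insertOnes m x) (insertOnes m y) = insertOnes m y - insertOnes m x := by
    rw [dist_comm, Real.dist_eq, abs_of_pos (sub_pos.2 (insertOnes_strictMonoOn m hm hx hy hxy))]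
  have h := rpow_le_insertOnes_sub m hm hx hy hxy
  rw [← hd, ← hd'] at h
  have h' := Real.rpow_le_rpow (by positivity) h (z := (m : ℝ) / (m + 1)) (by positivity)
  rwa [← Real.rpow_mul dist_nonneg, div_mul_div_cancel₀ hm'.ne', div_self (by positivity),
    Real.rpow_one, Real.mul_rpow (by positivity) dist_nonneg] at h'

lemma dimH_le_dimH_insertOnes_image (hm : m ≠ 0) {N : Set ℝ} (hN : N ⊆ Set.Ico 0 1) :
    dimH N * ((m / (m + 1) : NNReal) : ENNReal) ≤ dimH (insertOnes m '' N) := by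
  have hm' : (0 : NNReal) < m := by exact_mod_cast Nat.pos_of_ne_zero hm
  have hr : (0 : NNReal) < m / (m + 1) := by positivity
  have hinv : Set.LeftInvOn (Function.invFunOn (insertOnes m) (Set.Ico 0 1)) (insertOnes m)
      (Set.Ico (0 : ℝ) 1) := (insertOnes_strictMonoOn m hm).injOn.leftInvOn_invFunOn
  have hol : HolderOnWith ((2 ^ (m + 1)) ^ ((m : ℝ) / (m + 1))) (m / (m + 1))
      (Function.invFunOn (insertOnes m) (Set.Ico 0 1)) (insertOnes m '' N) := by
    rintro _ ⟨x, hx, rfl⟩ _ ⟨y, hy, rfl⟩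
    rw [hinv (hN hx), hinv (hN hy), edist_nndist, edist_nndist,
      ← ENNReal.coe_rpow_of_nonneg _ (by positivity), ← ENNReal.coe_mul, ENNReal.coe_le_coe,
      ← NNReal.coe_le_coe]
    push_cast
    exact dist_le_insertOnes m hm (hN hx) (hN hy)
  have h := hol.dimH_image_le hr
  rw [(hinv.mono hN).image_image] at h
  rwa [ENNReal.le_div_iff_mul_le (.inl (by exact_mod_cast hr.ne')) (.inl ENNReal.coe_ne_top)] at h

end insertOnes

lemma half_le_fract_div_two_pow_iff (d : ℕ) (b : ℤ) {v : ℝ} (hv : v ∈ Set.Ico (0 : ℝ) 1) :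
    1 / 2 ≤ Int.fract ((b + v) / 2 ^ (d + 1)) ↔ 2 ^ d ≤ b % 2 ^ (d + 1) := by
  have hp : (0 : ℤ) < 2 ^ (d + 1) := by positivity
  have hr0 : (0 : ℝ) ≤ (b % 2 ^ (d + 1) : ℤ) := by exact_mod_cast Int.emod_nonneg b hp.ne'
  have hr1 : ((b % 2 ^ (d + 1) : ℤ) : ℝ) + 1 ≤ 2 ^ (d + 1) := by
    exact_mod_cast Int.emod_lt_of_pos b hp
  have hb : (b : ℝ) = (b % 2 ^ (d + 1) : ℤ) + 2 ^ (d + 1) * (b / 2 ^ (d + 1) : ℤ) := by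
    exact_mod_cast (Int.emod_add_mul_ediv b (2 ^ (d + 1))).symm
  have hf : Int.fract ((b + v) / 2 ^ (d + 1)) = ((b % 2 ^ (d + 1) : ℤ) + v) / 2 ^ (d + 1) := by
    rw [Int.fract_eq_iff]
    refine ⟨div_nonneg (add_nonneg hr0 hv.1) (by positivity), ?_, b / 2 ^ (d + 1), ?_⟩
    · rw [div_lt_one (by positivity)]
      linarith [hv.2]
    · rw [hb]
      simp only [← hb]
      field_simp
      linarith
  rw [hf, le_div_iff₀ (by positivity), pow_succ (2 : ℝ)]
  constructor
  · intro h
    have h' : (2 : ℝ) ^ d < ((b % 2 ^ (d + 1) : ℤ) : ℝ) + 1 := by linarith [hv.2]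
    have : (2 : ℤ) ^ d < b % 2 ^ (d + 1) + 1 := by exact_mod_cast h'
    omega
  · intro h
    have : (2 : ℝ) ^ d ≤ ((b % 2 ^ (d + 1) : ℤ) : ℝ) := by exact_mod_cast h
    linarith [hv.1]

section count

variable {m : ℕ} {x : ℝ}

lemma onesCount_succ_insertOnes (hm : m ≠ 0) (hx : x ∈ Set.Ico (0 : ℝ) 1) :
    onesCount (m + 1) (insertOnes m x) = onesCount m x + 1 := by
  have hw := insertOnes_mem_Ico m hm
    (x := Int.fract (2 ^ m * x)) ⟨Int.fract_nonneg _, Int.fract_lt_one _⟩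
  have hg := insertOnes_eq m hx
  set w := insertOnes m (Int.fract (2 ^ m * x))
  set b := ⌊2 ^ m * x⌋ with hb
  have hw' : (1 + w) / 2 ∈ Set.Ico (0 : ℝ) 1 :=
    ⟨by linarith [hw.1], by linarith [hw.2]⟩
  rw [onesCount_add]
  congr 1
  · unfold onesCount
    congr 1
    refine Finset.filter_congr fun k hk => ?_
    obtain ⟨d, hd⟩ := Nat.exists_eq_add_of_lt (Finset.mem_range.1 hk)
    have hpow : (2 : ℝ) ^ m = 2 ^ k * 2 ^ (d + 1) := by rw [hd, add_assoc, pow_add]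
    have h1 : 2 ^ k * insertOnes m x = (b + (1 + w) / 2) / 2 ^ (d + 1) := by
      rw [hg, pow_succ, hpow]
      field_simp
      ring
    have h2 : 2 ^ k * x = (b + Int.fract (2 ^ m * x)) / 2 ^ (d + 1) := by
      rw [hb, Int.floor_add_fract, hpow]
      field_simp
    rw [h1, h2, half_le_fract_div_two_pow_iff d b hw',
      half_le_fract_div_two_pow_iff d b ⟨Int.fract_nonneg _, Int.fract_lt_one _⟩]
  · have h1 : 2 ^ m * insertOnes m x = b + (1 + w) / 2 := by
      rw [hg, pow_succ]
      field_simp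
      ring
    rw [h1, onesCount, Finset.range_one, Finset.filter_singleton, if_pos, Finset.card_singleton]
    rw [pow_zero, one_mul, Int.fract_intCast_add, Int.fract_eq_self.2 ⟨hw'.1, hw'.2⟩]
    linarith [hw.1]

lemma onesCount_mul_insertOnes (hm : m ≠ 0) (q : ℕ) (hx : x ∈ Set.Ico (0 : ℝ) 1) :
    onesCount ((m + 1) * q) (insertOnes m x) = onesCount (m * q) x + q := by
  induction q generalizing x with
  | zero => simp [onesCount]
  | succ q ih =>
    have hT : Int.fract (2 ^ m * x) ∈ Set.Ico (0 : ℝ) 1 := ⟨Int.fract_nonneg _, Int.fract_lt_one _⟩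
    have hw := insertOnes_mem_Ico m hm hT
    have h : Int.fract (2 ^ (m + 1) * insertOnes m x) = insertOnes m (Int.fract (2 ^ m * x)) := by
      rw [Int.fract_eq_iff]
      refine ⟨hw.1, hw.2, 2 * ⌊2 ^ m * x⌋ + 1, ?_⟩
      rw [insertOnes_eq m hx]
      push_cast
      field_simp
      ring
    rw [mul_add_one, add_comm _ (m + 1), onesCount_add, ← onesCount_fract _ (_ * _), h, ih hT,
      onesCount_succ_insertOnes hm hx, mul_add_one, add_comm _ m, onesCount_add,
      ← onesCount_fract _ (2 ^ m * x)]
    ring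

lemma half_lt_liminf_insertOnes (hm : m ≠ 0) (hx : x ∈ Set.Ico (0 : ℝ) 1)
    (h : Tendsto (fun n : ℕ => (onesCount n x : ℝ) / n) atTop (nhds (1 / 2))) :
    1 / 2 < liminf (fun n : ℕ => (onesCount n (insertOnes m x) : ℝ) / n) atTop := by
  have hm' : (0 : ℝ) < m := by exact_mod_cast Nat.pos_of_ne_zero hm
  have hc : (1 / 2 : ℝ) < 1 / 2 + 1 / (4 * (m + 1)) := by
    have : (0 : ℝ) < 1 / (4 * (m + 1)) := by positivity
    linarith
  refine hc.trans_le (le_liminf_of_le ?_ ?_)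
  · refine IsBoundedUnder.isCoboundedUnder_ge ⟨1, eventually_map.2 (.of_forall fun n => ?_)⟩
    refine div_le_one_of_le₀ ?_ (Nat.cast_nonneg n)
    exact_mod_cast (Finset.card_filter_le _ _).trans (Finset.card_range n).le
  have hq : Tendsto (fun n : ℕ => n / (m + 1)) atTop atTop :=
    Nat.tendsto_div_const_atTop (Nat.succ_ne_zero m)
  have hmq : Tendsto (fun n : ℕ => m * (n / (m + 1))) atTop atTop :=
    hq.const_mul_atTop' (Nat.pos_of_ne_zero hm)
  have hδ : (1 / 2 - 1 / (8 * m) : ℝ) < 1 / 2 := by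
    have : (0 : ℝ) < 1 / (8 * m) := by positivity
    linarith
  filter_upwards [hmq.eventually (h.eventually (lt_mem_nhds hδ)),
    hq.eventually (eventually_ge_atTop (4 * (m + 1) + 2))] with n h1 h2
  set q := n / (m + 1) with hqdef
  have hqpos : 0 < q := by omega
  have hqR : (0 : ℝ) < q := by exact_mod_cast hqpos
  have hn1 : (m + 1) * q ≤ n := Nat.mul_div_le n (m + 1)
  have hn2 : n < (m + 1) * (q + 1) := Nat.lt_mul_div_succ n (Nat.succ_pos m)
  have hnpos : (0 : ℝ) < n := by
    have : 0 < (m + 1) * q := by positivity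
    exact_mod_cast this.trans_le hn1
  have hη : ((onesCount (m * q) x : ℝ) + q) ≤ onesCount n (insertOnes m x) := by
    exact_mod_cast (onesCount_mul_insertOnes hm q hx).symm.trans_le
      (onesCount_mono (insertOnes m x) hn1)
  have hn2' : (n : ℝ) ≤ (m + 1) * (q + 1) := by exact_mod_cast hn2.le
  have h2' : (4 * (m + 1) + 2 : ℝ) ≤ q := by exact_mod_cast h2
  push_cast at h1
  rw [lt_div_iff₀ (by positivity)] at h1
  have h1' : (1 / 2 - 1 / (8 * m) : ℝ) * (m * q) = m * q / 2 - q / 8 := by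
    field_simp
  rw [h1'] at h1
  rw [le_div_iff₀ hnpos]
  calc (1 / 2 + 1 / (4 * (m + 1)) : ℝ) * n
      ≤ (1 / 2 + 1 / (4 * (m + 1))) * ((m + 1) * (q + 1)) := by gcongr
    _ = ((m + 1) / 2 + 1 / 4) * (q + 1) := by
      field_simp
    _ ≤ m * q / 2 - q / 8 + q := by nlinarith
    _ ≤ _ := by linarith

end count

lemma one_le_dimH_normal :
    1 ≤ dimH (Set.Ico (0 : ℝ) 1 ∩
      {x | Tendsto (fun n : ℕ => (onesCount n x : ℝ) / n) atTop (nhds (1 / 2))}) := by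
  refine le_dimH_of_hausdorffMeasure_ne_zero (d := 1) ?_
  rw [NNReal.coe_one, hausdorffMeasure_real, Set.inter_comm,
    ← Measure.restrict_apply' measurableSet_Ico]
  have h : unitMeasure _ = 1 := (prob_compl_eq_zero_iff₀ ?_).1 ae_tendsto_onesCount_div
  · exact h.trans_ne one_ne_zero
  · exact .of_compl (.of_null ae_tendsto_onesCount_div)

/-- The set of points of `[0,1)` at which the binary digit `1` occurs with lower asymptotic
frequency strictly greater than `1/2` has Lebesgue measure zero and Hausdorff dimension `1`.
Here `s_k(x) = 1` iff the fractional part of `2^k x` is `≥ 1/2`, and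
`η_n(x) = #{0 ≤ k < n : s_k(x) = 1}`. -/
theorem stmt_9 :
    volume {x : ℝ | x ∈ Set.Ico (0 : ℝ) 1 ∧
      (1 : ℝ) / 2 < Filter.liminf (fun n : ℕ =>
        (((Finset.range n).filter fun k : ℕ =>
          (1 : ℝ) / 2 ≤ Int.fract ((2 : ℝ) ^ k * x)).card : ℝ) / n) Filter.atTop} = 0 ∧
    dimH {x : ℝ | x ∈ Set.Ico (0 : ℝ) 1 ∧
      (1 : ℝ) / 2 < Filter.liminf (fun n : ℕ =>
        (((Finset.range n).filter fun k : ℕ =>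
          (1 : ℝ) / 2 ≤ Int.fract ((2 : ℝ) ^ k * x)).card : ℝ) / n) Filter.atTop} = 1 := by
  refine ⟨?_, le_antisymm ((dimH_mono (Set.subset_univ _)).trans_eq Real.dimH_univ) ?_⟩
  · have h := ae_tendsto_onesCount_div
    rw [ae_iff, unitMeasure, Measure.restrict_apply' measurableSet_Ico] at h
    refine measure_mono_null ?_ h
    rintro x ⟨hx, hlim⟩
    exact ⟨fun h : Tendsto _ _ _ => hlim.ne' h.liminf_eq, hx⟩
  · have hlim : Tendsto (fun m : ℕ => ((m / (m + 1) : NNReal) : ENNReal)) atTop (nhds 1) := by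
      rw [← ENNReal.coe_one, ENNReal.tendsto_coe, ← NNReal.tendsto_coe]
      push_cast
      exact tendsto_natCast_div_add_atTop 1
    refine le_of_tendsto hlim ((eventually_ne_atTop 0).mono fun m hm => ?_)
    have hN := dimH_le_dimH_insertOnes_image m hm
      (N := Set.Ico (0 : ℝ) 1 ∩
        {x | Tendsto (fun n : ℕ => (onesCount n x : ℝ) / n) atTop (nhds (1 / 2))})
      Set.inter_subset_left
    rw [((dimH_mono (Set.subset_univ _)).trans_eq Real.dimH_univ).antisymm one_le_dimH_normal,
      one_mul] at hN
    refine hN.trans (dimH_mono ?_)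
    rintro _ ⟨x, ⟨hx, h⟩, rfl⟩
    exact ⟨insertOnes_mem_Ico m hm hx, half_lt_liminf_insertOnes hm hx h⟩
end

section
/- Let N ≥ 2, β ∈ (0,1) and C > 0. Suppose (μ_c)_{c ∈ [0,1]^{N−1}} is a family of Borel probability measures on ℝ^N, measurable in c (i.e. c ↦ μ_c(A) is measurable for every Borel set A), such that for Lebesgue-almost every c ∈ [0,1]^{N−1}: μ_c is supported on the segment {c} × [0,1] ⊂ ℝ^N, and μ_c( {c} × I ) ≤ C |I|^{1−β} for every interval I ⊆ [0,1]. Let L ⊆ ℝ^N be a Borel set such that μ_c(L) = 1 for Lebesgue-almost every c ∈ [0,1]^{N−1}. Then the Hausdorff dimension of L is at least N − β. -/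
open MeasureTheory Filter

/-- **Mass distribution principle**: if a Borel measure `μ` satisfies `μ s ≤ K (diam s)^d` for all
sets of small diameter and charges `L`, then `L` has Hausdorff dimension at least `d`. -/
theorem le_dimH_of_measure_le_ediam_rpow {X : Type*} [EMetricSpace X] [MeasurableSpace X]
    [BorelSpace X] {μ : Measure X} {K ε : ENNReal} {d : NNReal} {L : Set X}
    (hK0 : K ≠ 0) (hK : K ≠ ⊤) (hε : 0 < ε)
    (h : ∀ s : Set X, Metric.ediam s ≤ ε → μ s ≤ K * Metric.ediam s ^ (d : ℝ)) (hL : μ L ≠ 0) :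
    (d : ENNReal) ≤ dimH L := by
  have hle : K⁻¹ • μ ≤ Measure.hausdorffMeasure (d : ℝ) := by
    refine Measure.le_hausdorffMeasure _ _ ε hε fun s hs => ?_
    rw [Measure.smul_apply, smul_eq_mul]
    calc K⁻¹ * μ s ≤ K⁻¹ * (K * Metric.ediam s ^ (d : ℝ)) := by gcongr; exact h s hs
      _ = Metric.ediam s ^ (d : ℝ) := by
        rw [← mul_assoc, ENNReal.inv_mul_cancel hK0 hK, one_mul]
  refine le_dimH_of_hausdorffMeasure_ne_zero fun h0 => ?_
  have hz : (K⁻¹ • μ) L = 0 := le_antisymm ((hle L).trans_eq h0) (zero_le)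
  rw [Measure.smul_apply, smul_eq_mul, mul_eq_zero, ENNReal.inv_eq_zero] at hz
  exact hz.elim hK hL

/-- A probability measure on a vertical segment with a Frostman-type bound on subintervals gives
small mass to a product of closed balls, and none if its base misses the segment. -/
theorem fiber_measure_closedBall_prod_le {E : Type*} [PseudoMetricSpace E] [MeasurableSpace E]
    [MeasurableSingletonClass E] {γ C : ℝ} (hγ : 0 < γ) (hC : 0 < C) {ν : Measure (E × ℝ)}
    [IsProbabilityMeasure ν] {c : E} (hsupp : ν ({c} ×ˢ Set.Icc (0 : ℝ) 1) = 1)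
    (hbound : ∀ t₁ t₂ : ℝ, t₁ ≤ t₂ → Set.Icc t₁ t₂ ⊆ Set.Icc (0 : ℝ) 1 →
      ν ({c} ×ˢ Set.Icc t₁ t₂) ≤ ENNReal.ofReal (C * (t₂ - t₁) ^ γ))
    (x : E) (t r : ℝ) :
    ν (Metric.closedBall x r ×ˢ Metric.closedBall t r) ≤
      (Metric.closedBall x r).indicator (fun _ => ENNReal.ofReal (C * (2 * r) ^ γ)) c := by
  have hS : MeasurableSet ({c} ×ˢ Set.Icc (0 : ℝ) 1 : Set (E × ℝ)) :=
    (measurableSet_singleton c).prod measurableSet_Icc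
  have hSc : ν ({c} ×ˢ Set.Icc (0 : ℝ) 1)ᶜ = 0 := (prob_compl_eq_zero_iff hS).2 hsupp
  by_cases hc : c ∈ Metric.closedBall x r
  · rw [Set.indicator_of_mem hc]
    have hsub : (Metric.closedBall x r ×ˢ Metric.closedBall t r : Set (E × ℝ)) ⊆
        ({c} ×ˢ Set.Icc (max 0 (t - r)) (min 1 (t + r))) ∪ ({c} ×ˢ Set.Icc (0 : ℝ) 1)ᶜ := by
      rintro ⟨y, s⟩ ⟨-, hs⟩
      by_cases hys : (y, s) ∈ ({c} ×ˢ Set.Icc (0 : ℝ) 1 : Set (E × ℝ))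
      · rw [Real.closedBall_eq_Icc] at hs
        exact Or.inl ⟨hys.1, max_le hys.2.1 hs.1, le_min hys.2.2 hs.2⟩
      · exact Or.inr hys
    calc ν (Metric.closedBall x r ×ˢ Metric.closedBall t r)
        ≤ ν ({c} ×ˢ Set.Icc (max 0 (t - r)) (min 1 (t + r))) := by
          refine (measure_mono hsub).trans ((measure_union_le _ _).trans ?_)
          rw [hSc, add_zero]
      _ ≤ ENNReal.ofReal (C * (2 * r) ^ γ) := by
          rcases le_or_gt (max 0 (t - r)) (min 1 (t + r)) with hle | hlt
          · refine (hbound _ _ hle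
              (Set.Icc_subset_Icc (le_max_left _ _) (min_le_left _ _))).trans ?_
            have h1 := le_max_right 0 (t - r)
            have h2 := min_le_right 1 (t + r)
            have h0 : 0 ≤ min 1 (t + r) - max 0 (t - r) := sub_nonneg.2 hle
            gcongr
            linarith
          · rw [Set.Icc_eq_empty (not_le.2 hlt), Set.prod_empty, measure_empty]
            exact zero_le
  · rw [Set.indicator_of_notMem hc]
    refine (measure_mono_null ?_ hSc).le
    rintro ⟨y, s⟩ ⟨hy, -⟩ hys
    exact hc (hys.1 ▸ hy)

/-- If `L` is a Borel set with `μ_c(L) = 1` for Lebesgue-a.e. `c ∈ [0,1]^{N−1}`, where each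
`μ_c` is a probability measure supported on `{c} × [0,1]` with `μ_c({c} × I) ≤ C|I|^{1−β}`
for all intervals `I ⊆ [0,1]`, then the Hausdorff dimension of `L` is at least `N − β`. -/
theorem stmt_13
    (N : ℕ) (hN : 2 ≤ N) (β : ℝ) (hβ0 : 0 < β) (hβ1 : β < 1) (C : ℝ) (hC : 0 < C)
    (μc : (Fin (N - 1) → ℝ) → Measure ((Fin (N - 1) → ℝ) × ℝ))
    (hprob : ∀ c, IsProbabilityMeasure (μc c))
    (hmeas : ∀ A : Set ((Fin (N - 1) → ℝ) × ℝ), MeasurableSet A → Measurable fun c => μc c A)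
    (hsupp : ∀ᵐ c ∂(volume.restrict (Set.univ.pi fun _ : Fin (N - 1) => Set.Icc (0 : ℝ) 1)),
      μc c ({c} ×ˢ Set.Icc (0 : ℝ) 1) = 1 ∧
      ∀ t₁ t₂ : ℝ, t₁ ≤ t₂ → Set.Icc t₁ t₂ ⊆ Set.Icc (0 : ℝ) 1 →
        μc c ({c} ×ˢ Set.Icc t₁ t₂) ≤ ENNReal.ofReal (C * (t₂ - t₁) ^ (1 - β)))
    (L : Set ((Fin (N - 1) → ℝ) × ℝ)) (hL : MeasurableSet L)
    (hfull : ∀ᵐ c ∂(volume.restrict (Set.univ.pi fun _ : Fin (N - 1) => Set.Icc (0 : ℝ) 1)),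
      μc c L = 1) :
    ENNReal.ofReal ((N : ℝ) - β) ≤ dimH L := by
  set Q : Set (Fin (N - 1) → ℝ) := Set.univ.pi fun _ => Set.Icc (0 : ℝ) 1 with hQ
  have hμc : Measurable μc := Measure.measurable_of_measurable_coe _ hmeas
  set μ := (volume.restrict Q).bind μc
  have hμL : μ L = 1 := by
    rw [Measure.bind_apply hL hμc.aemeasurable, lintegral_congr_ae hfull, lintegral_one,
      Measure.restrict_apply_univ, hQ, volume_pi_pi]
    simp
  have hNβ : 0 ≤ (N : ℝ) - β := by
    have : (2 : ℝ) ≤ N := by exact_mod_cast hN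
    linarith
  have hdiam : ∀ s : Set ((Fin (N - 1) → ℝ) × ℝ), Metric.ediam s ≤ 1 →
      μ s ≤ ENNReal.ofReal (C * 2 ^ ((N : ℝ) - β)) *
        Metric.ediam s ^ ((((N : ℝ) - β).toNNReal : NNReal) : ℝ) := by
    intro s hs
    rcases s.eq_empty_or_nonempty with rfl | ⟨⟨x, t⟩, hxt⟩
    · simp
    have htop : Metric.ediam s ≠ ⊤ := ne_top_of_le_ne_top ENNReal.one_ne_top hs
    have hr : 0 ≤ Metric.diam s := Metric.diam_nonneg
    have hed : Metric.ediam s = ENNReal.ofReal (Metric.diam s) := (ENNReal.ofReal_toReal htop).symm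
    set r := Metric.diam s
    have hsub : s ⊆ Metric.closedBall x r ×ˢ Metric.closedBall t r := by
      rw [closedBall_prod_same]
      exact fun y hy => Metric.dist_le_diam_of_mem' htop hy hxt
    calc μ s ≤ μ (Metric.closedBall x r ×ˢ Metric.closedBall t r) := measure_mono hsub
      _ = ∫⁻ c in Q, μc c (Metric.closedBall x r ×ˢ Metric.closedBall t r) :=
        Measure.bind_apply (measurableSet_closedBall.prod measurableSet_closedBall)
          hμc.aemeasurable
      _ ≤ ∫⁻ c in Q, (Metric.closedBall x r).indicator
            (fun _ => ENNReal.ofReal (C * (2 * r) ^ (1 - β))) c :=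
        lintegral_mono_ae (hsupp.mono fun c hc =>
          fiber_measure_closedBall_prod_le (sub_pos.2 hβ1) hC hc.1 hc.2 x t r)
      _ ≤ ∫⁻ c, (Metric.closedBall x r).indicator
            (fun _ => ENNReal.ofReal (C * (2 * r) ^ (1 - β))) c :=
        setLIntegral_le_lintegral _ _
      _ = ENNReal.ofReal (C * (2 * r) ^ (1 - β)) * ENNReal.ofReal ((2 * r) ^ (N - 1)) := by
        rw [lintegral_indicator_const measurableSet_closedBall, Real.volume_pi_closedBall _ hr,
          Fintype.card_fin]
      _ = ENNReal.ofReal (C * 2 ^ ((N : ℝ) - β)) *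
            Metric.ediam s ^ ((((N : ℝ) - β).toNNReal : NNReal) : ℝ) := by
        have hexp : (N : ℝ) - β = (1 - β) + ((N - 1 : ℕ) : ℝ) := by
          rw [Nat.cast_sub (by lia)]
          push_cast
          ring
        rw [Real.coe_toNNReal _ hNβ, hed, ENNReal.ofReal_rpow_of_nonneg hr hNβ,
          ← ENNReal.ofReal_mul (by positivity), ← ENNReal.ofReal_mul (by positivity), mul_assoc C,
          mul_assoc C, ← Real.mul_rpow (by norm_num) hr, hexp,
          Real.rpow_add_of_nonneg (by positivity) (sub_pos.2 hβ1).le (Nat.cast_nonneg _),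
          Real.rpow_natCast]
  exact le_dimH_of_measure_le_ediam_rpow (ENNReal.ofReal_pos.2 (by positivity)).ne'
    ENNReal.ofReal_ne_top one_pos hdiam (by simp [hμL])
end
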